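/- Let (Ω,T) be a subshift over a finite alphabet, f : Ω → ℝ∖{0} and g : Ω → ℝ locally constant, and let ω ∈ Ω admit a sequence (w_k) of finite words with |w_k| → ∞ such that for each k the threefold concatenation w_k w_k w_k occurs in ω at position −|w_k| or at position −2|w_k|. Then the Jacobi operator H_ω has no eigenvalues: for every E ∈ ℝ there is no nonzero u ∈ ℓ²(ℤ) with H_ω u = E u. -/

import Mathlib

open Filter Topology MeasureTheory

noncomputable section

abbrev SL2 := Matrix.SpecialLinearGroup (Fin 2) ℝ

/-- Operator norm of a 2×2 real matrix acting on Euclidean ℝ². -/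
def matNorm (M : Matrix (Fin 2) (Fin 2) ℝ) : ℝ :=
  ‖LinearMap.toContinuousLinearMap (Matrix.toEuclideanLin M)‖

/-- Norm of an element of SL(2,ℝ). -/
def slNorm (M : SL2) : ℝ := matNorm (M : Matrix (Fin 2) (Fin 2) ℝ)

/-- Action of an SL(2,ℝ) matrix on a euclidean vector. -/
def slAct (M : SL2) (v : EuclideanSpace ℝ (Fin 2)) : EuclideanSpace ℝ (Fin 2) :=
  Matrix.toEuclideanLin (M : Matrix (Fin 2) (Fin 2) ℝ) v

variable {𝒜 : Type*}

/-- The shift by `k` on two-sided sequences; `shift 1` is the left shift `T`. -/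
def shift (k : ℤ) (ω : ℤ → 𝒜) : ℤ → 𝒜 := fun n => ω (n + k)

/-- `Ω ⊆ 𝒜^ℤ` is a subshift: nonempty, closed, invariant under the shift and its inverse. -/
structure IsSubshift [TopologicalSpace 𝒜] (Ω : Set (ℤ → 𝒜)) : Prop where
  nonempty : Ω.Nonempty
  closed : IsClosed Ω
  shift_mem : ∀ ω ∈ Ω, shift 1 ω ∈ Ω
  shift_neg_mem : ∀ ω ∈ Ω, shift (-1) ω ∈ Ω

/-- The word `ω(k) ω(k+1) ⋯ ω(k+n-1)`. -/
def word (ω : ℤ → 𝒜) (k : ℤ) (n : ℕ) : List 𝒜 := (List.range n).map fun i => ω (k + i)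

/-- `v` occurs in `ω` at position `k`. -/
def occursAt (v : List 𝒜) (ω : ℤ → 𝒜) (k : ℤ) : Prop := v = word ω k v.length

/-- The words of length `n` occurring in elements of `Ω`. -/
def WordsN (Ω : Set (ℤ → 𝒜)) (n : ℕ) : Set (List 𝒜) :=
  {v | ∃ ω ∈ Ω, ∃ k : ℤ, v = word ω k n}

/-- The (nonempty) finite words occurring in elements of `Ω`. -/
def Words (Ω : Set (ℤ → 𝒜)) : Set (List 𝒜) :=
  {v | 1 ≤ v.length ∧ v ∈ WordsN Ω v.length}

/-- `A` is locally constant on `Ω`: its value depends only on a finite window around 0. -/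
def LocConstOn (Ω : Set (ℤ → 𝒜)) {β : Type*} (A : (ℤ → 𝒜) → β) : Prop :=
  ∃ N : ℕ, ∀ ω ∈ Ω, ∀ ρ ∈ Ω, (∀ i : ℤ, |i| ≤ (N : ℤ) → ω i = ρ i) → A ω = A ρ

/-- The positive part of the cocycle: `cocycleP A n ω = A(T^{n-1}ω) ⋯ A(ω)`. -/
def cocycleP (A : (ℤ → 𝒜) → SL2) : ℕ → (ℤ → 𝒜) → SL2
  | 0, _ => 1
  | n + 1, ω => A (shift n ω) * cocycleP A n ω

/-- The full cocycle over the shift, `n ∈ ℤ`. -/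
def cocycle (A : (ℤ → 𝒜) → SL2) (n : ℤ) (ω : ℤ → 𝒜) : SL2 :=
  if 0 ≤ n then cocycleP A n.toNat ω else (cocycleP A (-n).toNat (shift n ω))⁻¹

/-- `A` is uniform on `Ω`: `(1/n) log‖A(n,ω)‖` converges uniformly on `Ω`. -/
def IsUniform (Ω : Set (ℤ → 𝒜)) (A : (ℤ → 𝒜) → SL2) : Prop :=
  ∃ Λ : ℝ, TendstoUniformlyOn
    (fun (n : ℕ) (ω : ℤ → 𝒜) => Real.log (slNorm (cocycle A n ω)) / n)
    (fun _ => Λ) atTop Ω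

/-- The number of occurrences of `v` in `ω(1)⋯ω(n)`. -/
def occCount (v : List 𝒜) (ω : ℤ → 𝒜) (n : ℕ) : ℕ :=
  Set.ncard {k : ℤ | 1 ≤ k ∧ k + v.length ≤ (n : ℤ) + 1 ∧ occursAt v ω k}

/-- Uniform existence of word frequencies (unique ergodicity). -/
def UniformWordFreq (Ω : Set (ℤ → 𝒜)) : Prop :=
  ∀ v ∈ Words Ω, ∃ ν : ℝ, TendstoUniformlyOn
    (fun (n : ℕ) (ω : ℤ → 𝒜) => (occCount v ω n : ℝ) / n) (fun _ => ν) atTop Ω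

/-- Minimality: every orbit is dense in `Ω`. -/
def IsMinimalSubshift [TopologicalSpace 𝒜] (Ω : Set (ℤ → 𝒜)) : Prop :=
  ∀ ω ∈ Ω, ∀ ρ ∈ Ω, ρ ∈ closure {σ : ℤ → 𝒜 | ∃ k : ℤ, σ = shift k ω}

/-- Condition (α): for all large `n`, the words of length `n` of `Ω` are exactly the
words `lead j (-k+1) ⋯ lead j (-k+n)`, `0 ≤ k ≤ n`, of the leading words. -/
def CondAlpha (Ω : Set (ℤ → 𝒜)) {r : ℕ} (lead : Fin r → (ℤ → 𝒜)) : Prop :=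
  (∀ j, lead j ∈ Ω) ∧ ∃ N : ℕ, ∀ n : ℕ, N ≤ n →
    WordsN Ω n = {v | ∃ j : Fin r, ∃ k : ℕ, k ≤ n ∧ v = word (lead j) (1 - (k : ℤ)) n}

/-- Condition (β): for every locally constant cocycle the Lyapunov limits along the
leading words exist in both time directions and all have the same value. -/
def CondBeta (Ω : Set (ℤ → 𝒜)) {r : ℕ} (lead : Fin r → (ℤ → 𝒜)) : Prop :=
  ∀ A : (ℤ → 𝒜) → SL2, LocConstOn Ω A → ∃ Λ : ℝ, ∀ j : Fin r,
    Tendsto (fun n : ℕ => Real.log (slNorm (cocycle A n (lead j))) / n) atTop (𝓝 Λ) ∧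
    Tendsto (fun n : ℕ => Real.log (slNorm (cocycle A (-(n : ℤ)) (lead j))) / n) atTop (𝓝 Λ)

/-- Condition (γ): along the leading words, for every locally constant cocycle and every
nonzero vector, at most one of the two one-sided exponents is negative. -/
def CondGamma (Ω : Set (ℤ → 𝒜)) {r : ℕ} (lead : Fin r → (ℤ → 𝒜)) : Prop :=
  ∀ A : (ℤ → 𝒜) → SL2, LocConstOn Ω A → ∀ j : Fin r,
    ∀ v : EuclideanSpace ℝ (Fin 2), v ≠ 0 →
    ¬ (limsup (fun n : ℕ => Real.log ‖slAct (cocycle A n (lead j)) v‖ / n) atTop < 0 ∧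
       limsup (fun n : ℕ => Real.log ‖slAct (cocycle A (-(n : ℤ)) (lead j)) v‖ / n) atTop < 0)

/-- The leading sequence condition (LSC). -/
def SatisfiesLSC (Ω : Set (ℤ → 𝒜)) : Prop :=
  ∃ (r : ℕ) (lead : Fin r → (ℤ → 𝒜)), CondAlpha Ω lead ∧ CondBeta Ω lead ∧ CondGamma Ω lead

/-- `F` is subadditive on the words of `Ω`. -/
def SubadditiveOn (Ω : Set (ℤ → 𝒜)) (F : List 𝒜 → ℝ) : Prop :=
  ∀ x y : List 𝒜, x ∈ Words Ω → y ∈ Words Ω → (x ++ y) ∈ Words Ω → F (x ++ y) ≤ F x + F y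

/-- `Fb` is the asymptotic mean `lim_n max { F x / n : x ∈ W(Ω)_n }` of `F`. -/
def IsAsympMean (Ω : Set (ℤ → 𝒜)) (F : List 𝒜 → ℝ) (Fb : ℝ) : Prop :=
  Tendsto (fun n : ℕ => sSup ((fun x => F x / n) '' WordsN Ω n)) atTop (𝓝 Fb)

/-- Maximal number of pairwise disjoint occurrences of `v` in `ω(1)⋯ω(n)`. -/
def disjCount (v : List 𝒜) (ω : ℤ → 𝒜) (n : ℕ) : ℕ :=
  sSup {m : ℕ | ∃ S : Finset ℤ, S.card = m ∧
    (∀ k ∈ S, 1 ≤ k ∧ k + v.length ≤ (n : ℤ) + 1 ∧ occursAt v ω k) ∧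
    (∀ k ∈ S, ∀ l ∈ S, k ≠ l → (v.length : ℤ) ≤ |k - l|)}

/-- Condition (PQ) for the one-sided word `p(1)p(2)⋯`. -/
def CondPQ (p : ℤ → 𝒜) : Prop :=
  ∃ c : ℝ, 0 < c ∧ ∀ m : ℕ, 1 ≤ m →
    c ≤ liminf (fun n : ℕ => (m : ℝ) / n * disjCount (word p 1 m) p n) atTop

/-- ℓ²(ℤ) over the reals. -/
abbrev Ell2Z : Type := lp (fun _ : ℤ => ℝ) 2

/-- `H` acts as the Jacobi operator with coefficients `f, g` at `ω`. -/
def IsJacobiAt (f g : (ℤ → 𝒜) → ℝ) (ω : ℤ → 𝒜) (H : Ell2Z →L[ℝ] Ell2Z) : Prop :=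
  ∀ u : Ell2Z, ∀ n : ℤ,
    (H u : ∀ _ : ℤ, ℝ) n =
      f (shift n ω) * (u : ∀ _ : ℤ, ℝ) (n - 1) + f (shift (n + 1) ω) * (u : ∀ _ : ℤ, ℝ) (n + 1)
        + g (shift n ω) * (u : ∀ _ : ℤ, ℝ) n

/-- The pair `(f,g)` is periodic on `Ω`. -/
def PeriodicPair (Ω : Set (ℤ → 𝒜)) (f g : (ℤ → 𝒜) → ℝ) : Prop :=
  ∃ P : ℕ, 1 ≤ P ∧ ∀ ω ∈ Ω, f (shift (P : ℤ) ω) = f ω ∧ g (shift (P : ℤ) ω) = g ω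

/-- `S ⊆ ℝ` is a Cantor set of Lebesgue measure zero: compact, empty interior,
no isolated points, Lebesgue measure zero. -/
def IsMeasureZeroCantor (S : Set ℝ) : Prop :=
  IsCompact S ∧ interior S = ∅ ∧ Perfect S ∧ volume S = 0

/-- `n` copies of `x` separated by `n-1` copies of the letter `l`. -/
def sepJoin (x : List 𝒜) (l : 𝒜) (m : ℕ) : List 𝒜 :=
  (List.replicate (m - 1) (x ++ [l])).flatten ++ x

/-- `Blk a nseq (k+1)` is the block `block(k)` of the simple Toeplitz construction
(with `Blk a nseq 0 = block(-1) = ε`). -/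
def Blk (a : ℕ → 𝒜) (nseq : ℕ → ℕ) : ℕ → List 𝒜
  | 0 => []
  | k + 1 => sepJoin (Blk a nseq k) (a k) (nseq k)

/-- `p(1)p(2)⋯` is the one-sided word `block(∞)`: every block is a prefix of it. -/
def IsBlockInf (a : ℕ → 𝒜) (nseq : ℕ → ℕ) (p : ℤ → 𝒜) : Prop :=
  ∀ k : ℕ, word p 1 (Blk a nseq k).length = Blk a nseq k

/-- The simple Toeplitz subshift generated by `block(∞) = p(1)p(2)⋯`: all two-sided
sequences whose finite subwords all occur in `block(∞)`. -/
def toeplitzΩ (p : ℤ → 𝒜) : Set (ℤ → 𝒜) :=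
  {ω | ∀ (i : ℤ) (n : ℕ), ∃ l : ℤ, 1 ≤ l ∧ word ω i n = word p l n}

/-- The eventual alphabet: letters occurring infinitely often in `(a_k)`. -/
def EvAlph (a : ℕ → 𝒜) : Set 𝒜 := {x | ∀ K : ℕ, ∃ k, K ≤ k ∧ a k = x}

/-- The leading word `p^R v | p`: equals `p(n+1)` for `n ≥ 0`, carries the word `v` on
positions `-|v|, …, -1`, and equals `p(-(n+|v|))` for `n < -|v|`. -/
def leadWordGen (p : ℤ → 𝒜) (v : List 𝒜) : ℤ → 𝒜 := fun n =>
  if 0 ≤ n then p (n + 1)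
  else if -(v.length : ℤ) ≤ n then v.getD (n + v.length).toNat (p 1)
  else p (-(n + v.length))

/-- The Gauss map. -/
def gaussMap (x : ℝ) : ℝ := 1 / x - ⌊1 / x⌋

/-- `cfSeq α n` is the continued fraction coefficient `a_{n+1}` of `α`. -/
def cfSeq (α : ℝ) (n : ℕ) : ℕ := ⌊1 / (gaussMap^[n] α)⌋₊

/-- The standard Sturmian words: `sturmW α (n+1) = s_n`, `sturmW α 0 = s_{-1} = 1`,
`sturmW α 1 = s_0 = 0`, `s_1 = s_0^{a_1 - 1} s_{-1}`, `s_n = s_{n-1}^{a_n} s_{n-2}`. -/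
def sturmW (α : ℝ) : ℕ → List (Fin 2)
  | 0 => [1]
  | 1 => [0]
  | 2 => List.replicate (cfSeq α 0 - 1) (0 : Fin 2) ++ [1]
  | n + 3 => (List.replicate (cfSeq α (n + 1)) (sturmW α (n + 2))).flatten ++ sturmW α (n + 1)

/-- The Sturmian subshift with rotation number `α`: all two-sided sequences whose finite
subwords occur in some `s_n`. -/
def sturmΩ (α : ℝ) : Set (ℤ → Fin 2) :=
  {ω | ∀ (i : ℤ) (n : ℕ), ∃ m : ℕ, word ω i n <:+: sturmW α m}

/-- The positive cocycle of a map `A` over a transformation `T`: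
`cocycleH T A n ω = A(T^{n-1}ω) ⋯ A(ω)`. -/
def cocycleH {Ω : Type*} (T : Ω → Ω) (A : Ω → SL2) : ℕ → Ω → SL2
  | 0, _ => 1
  | n + 1, ω => A (T^[n] ω) * cocycleH T A n ω

end
def trP (A : ℤ → Matrix (Fin 2) (Fin 2) ℝ) (n : ℤ) : ℕ → Matrix (Fin 2) (Fin 2) ℝ
  | 0 => 1
  | k + 1 => A (n + k) * trP A n k

theorem trP_add (A : ℤ → Matrix (Fin 2) (Fin 2) ℝ) (n : ℤ) (j k : ℕ) :
    trP A n (j + k) = trP A (n + j) k * trP A n j := by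
  induction k with
  | zero => simp [trP]
  | succ k ih =>
    rw [← add_assoc, trP, ih, trP, ← mul_assoc]
    push_cast
    rw [add_assoc n]

theorem trP_congr (A : ℤ → Matrix (Fin 2) (Fin 2) ℝ) (n m : ℤ) (k : ℕ)
    (h : ∀ i : ℕ, i < k → A (n + i) = A (m + i)) : trP A n k = trP A m k := by
  induction k with
  | zero => simp [trP]
  | succ k ih =>
    rw [trP, trP, ih (fun i hi => h i (by omega)), h k (by omega)]

theorem trP_det (A : ℤ → Matrix (Fin 2) (Fin 2) ℝ) (hA : ∀ n, (A n).det = 1) (n : ℤ) (k : ℕ) :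
    (trP A n k).det = 1 := by
  induction k with
  | zero => simp [trP]
  | succ k ih => rw [trP, Matrix.det_mul, ih, hA, one_mul]

theorem trP_vec (A : ℤ → Matrix (Fin 2) (Fin 2) ℝ) (v : ℤ → Fin 2 → ℝ)
    (hv : ∀ n, v (n + 1) = (A n).mulVec (v n)) (n : ℤ) (k : ℕ) :
    v (n + k) = (trP A n k).mulVec (v n) := by
  induction k with
  | zero => simp [trP]
  | succ k ih =>
    rw [trP, ← Matrix.mulVec_mulVec, ← ih, ← hv]
    push_cast
    rw [add_assoc]

theorem mat_bound (A : ℤ → Matrix (Fin 2) (Fin 2) ℝ) (hA : (Set.range A).Finite) :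
    ∃ C : ℝ, 0 ≤ C ∧ ∀ n x, ‖(A n).mulVec x‖ ≤ C * ‖x‖ := by
  obtain ⟨C, hC⟩ := (hA.image
    (fun M => ‖LinearMap.toContinuousLinearMap (Matrix.mulVecLin M)‖)).bddAbove
  refine ⟨max C 0, le_max_right _ _, fun n x => ?_⟩
  have h1 := (LinearMap.toContinuousLinearMap (Matrix.mulVecLin (A n))).le_opNorm x
  have h2 := hC (Set.mem_image_of_mem _ (Set.mem_range_self n))
  refine h1.trans (mul_le_mul_of_nonneg_right (h2.trans (le_max_left _ _)) (norm_nonneg _))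

theorem trP_bound (A : ℤ → Matrix (Fin 2) (Fin 2) ℝ) (hA : (Set.range A).Finite) (k : ℕ) :
    ∃ C : ℝ, 0 ≤ C ∧ ∀ n x, ‖(trP A n k).mulVec x‖ ≤ C * ‖x‖ := by
  obtain ⟨C, hC0, hC⟩ := mat_bound A hA
  refine ⟨C ^ k, by positivity, fun n x => ?_⟩
  induction k with
  | zero => simp [trP]
  | succ k ih =>
    rw [trP, ← Matrix.mulVec_mulVec]
    refine (hC _ _).trans ?_
    rw [pow_succ', mul_assoc]
    exact mul_le_mul_of_nonneg_left ih hC0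

theorem cayley2 (M : Matrix (Fin 2) (Fin 2) ℝ) (h : M.det = 1) (x : Fin 2 → ℝ) :
    M.mulVec (M.mulVec x) + x = M.trace • M.mulVec x := by
  rw [Matrix.det_fin_two] at h
  ext i
  fin_cases i
  · simp [Matrix.mulVec, dotProduct, Fin.sum_univ_two, Matrix.trace_fin_two]
    linear_combination (-x 0) * h
  · simp [Matrix.mulVec, dotProduct, Fin.sum_univ_two, Matrix.trace_fin_two]
    linear_combination (-x 1) * h

theorem gordon_one (A : ℤ → Matrix (Fin 2) (Fin 2) ℝ) (hdet : ∀ n, (A n).det = 1)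
    (v : ℤ → Fin 2 → ℝ) (hv : ∀ n, v (n + 1) = (A n).mulVec (v n)) (N : ℕ) (C : ℝ) (hC0 : 0 ≤ C)
    (hC : ∀ n x, ‖(trP A n (2 * N)).mulVec x‖ ≤ C * ‖x‖) (p : ℕ) (hp : 2 * N ≤ p)
    (hper : ∀ n : ℤ, -p + N ≤ n → n + 1 + N ≤ p → A n = A (n + p)) :
    ‖v N‖ ≤ ‖v (N + p)‖ + ‖v (N - p)‖ + C * ‖v (2 * p - N)‖ := by
  obtain ⟨q, rfl⟩ := Nat.exists_eq_add_of_le' hp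
  set p := q + 2 * N with hpdef
  set M := trP A N p with hM
  have hM' : trP A ((N : ℤ) - p) p = M := by
    apply trP_congr
    intro i hi
    rw [hper _ (by omega) (by omega)]
    congr 1; ring
  have h1 : v (N + p) = M.mulVec (v N) := trP_vec A v hv N p
  have h0 : v N = M.mulVec (v (N - p)) := by
    have := trP_vec A v hv ((N : ℤ) - p) p
    rwa [hM', sub_add_cancel] at this
  have hd : M.det = 1 := trP_det A hdet _ _
  have hsplit : M = trP A (N + q) (2 * N) * trP A N q := trP_add A N q (2 * N)
  have hY : trP A ((N : ℤ) + p) q = trP A N q := by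
    symm
    apply trP_congr
    intro i hi
    rw [hper _ (by omega) (by omega)]
    congr 1; ring
  have h2 : v (2 * p - N) = (trP A N q).mulVec (v (N + p)) := by
    have := trP_vec A v hv ((N : ℤ) + p) q
    rw [hY] at this
    rw [← this]
    congr 1; push_cast [hpdef]; ring
  have h3 : M.mulVec (v (N + p)) = (trP A (N + q) (2 * N)).mulVec (v (2 * p - N)) := by
    rw [h2, Matrix.mulVec_mulVec, ← hsplit]
  have h4 : ‖M.mulVec (v (N + p))‖ ≤ C * ‖v (2 * p - N)‖ := by
    rw [h3]; exact hC _ _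
  rcases le_total |M.trace| 1 with ht | ht
  · have h5 := cayley2 M hd (v N)
    rw [← h1] at h5
    have h6 : v N = M.trace • v (N + p) - M.mulVec (v (N + p)) := by
      rw [← h5, add_sub_cancel_left]
    have h7 : ‖v N‖ ≤ |M.trace| * ‖v (N + p)‖ + ‖M.mulVec (v (N + p))‖ := by
      conv_lhs => rw [h6]
      refine (norm_sub_le _ _).trans ?_
      rw [norm_smul, Real.norm_eq_abs]
    have h8 := mul_le_mul_of_nonneg_right ht (norm_nonneg (v (N + p)))
    have := norm_nonneg (v (N - p))
    linarith
  · have h5 := cayley2 M hd (v (N - p))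
    rw [← h0, ← h1] at h5
    have h7 : |M.trace| * ‖v N‖ ≤ ‖v (N + p)‖ + ‖v (N - p)‖ := by
      rw [← Real.norm_eq_abs, ← norm_smul, ← h5]
      exact norm_add_le _ _
    have h8 := mul_le_mul_of_nonneg_right ht (norm_nonneg (v N))
    have : 0 ≤ C * ‖v (2 * p - N)‖ := by positivity
    linarith

theorem gordon_main (A : ℤ → Matrix (Fin 2) (Fin 2) ℝ) (hdet : ∀ n, (A n).det = 1)
    (hfin : (Set.range A).Finite)
    (v : ℤ → Fin 2 → ℝ) (hv : ∀ n, v (n + 1) = (A n).mulVec (v n))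
    (hv0 : Tendsto v cofinite (𝓝 0)) (N : ℕ)
    (l : ℕ → ℕ) (hl : Tendsto l atTop atTop)
    (hper : ∀ k, (∀ n : ℤ, -(l k) + N ≤ n → n + 1 + N ≤ l k → A n = A (n + l k)) ∨
      (∀ n : ℤ, -(2 * l k) + N ≤ n → n + 1 + N ≤ 0 → A n = A (n + l k))) :
    ∀ n, v n = 0 := by
  set A' : ℤ → Matrix (Fin 2) (Fin 2) ℝ := fun n => (A (-n - 1))⁻¹ with hA'
  set v' : ℤ → Fin 2 → ℝ := fun n => v (-n) with hv'
  have hdet' : ∀ n, (A' n).det = 1 := by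
    intro n; simp [hA', Matrix.det_nonsing_inv, hdet]
  have hfin' : (Set.range A').Finite := by
    refine (hfin.image (fun M => M⁻¹)).subset ?_
    rintro _ ⟨n, rfl⟩
    exact ⟨_, ⟨_, rfl⟩, rfl⟩
  have hvr' : ∀ n, v' (n + 1) = (A' n).mulVec (v' n) := by
    intro n
    have h := hv (-n - 1)
    simp only [hA', hv']
    rw [show -n - 1 + 1 = -n by ring] at h
    rw [h, Matrix.mulVec_mulVec, Matrix.nonsing_inv_mul _ (by simp [hdet]), Matrix.one_mulVec]
    congr 1; ring
  obtain ⟨C, hC0, hC⟩ := trP_bound A hfin (2 * N)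
  obtain ⟨C', hC0', hC'⟩ := trP_bound A' hfin' (2 * N)
  have hlim : ∀ a : ℕ → ℤ, Tendsto (fun k => |a k|) atTop atTop →
      Tendsto (fun k => ‖v (a k)‖) atTop (𝓝 0) := by
    intro a ha
    have h1 : Tendsto a atTop cofinite := by
      rw [Int.cofinite_eq, ← Filter.comap_abs_atTop]
      exact tendsto_comap_iff.2 ha
    simpa using (hv0.comp h1).norm
  have hl' : Tendsto (fun k => (l k : ℤ)) atTop atTop := tendsto_natCast_atTop_atTop.comp hl
  have ab : ∀ a : ℕ → ℤ, (∀ k, (l k : ℤ) - N ≤ |a k|) → Tendsto (fun k => ‖v (a k)‖) atTop (𝓝 0) := by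
    intro a ha
    apply hlim
    exact tendsto_atTop_mono ha (by simpa [sub_eq_add_neg] using tendsto_atTop_add_const_right atTop (-(N : ℤ)) hl')
  have R1 := ((ab (fun k => N + l k) (fun k => by grind)).add
    (ab (fun k => N - l k) (fun k => by grind))).add
    ((ab (fun k => 2 * l k - N) (fun k => by grind)).const_mul C)
  have R2 := ((ab (fun k => -(N + l k)) (fun k => by grind)).add
    (ab (fun k => -(N - l k)) (fun k => by grind))).add
    ((ab (fun k => -(2 * l k - N)) (fun k => by grind)).const_mul C')
  simp only [add_zero, mul_zero] at R1 R2
  have prop : ∀ n, v n = 0 → ∀ m, v m = 0 := by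
    intro n hn m
    rcases le_total n m with h | h
    · obtain ⟨k, rfl⟩ := Int.le.dest h
      rw [trP_vec A v hv, hn, Matrix.mulVec_zero]
    · obtain ⟨k, hk⟩ := Int.le.dest h
      have := trP_vec A' v' hvr' (-n) k
      simp only [hv', neg_neg, hn, Matrix.mulVec_zero] at this
      rw [← this]; congr 1; omega
  by_contra! hne
  obtain ⟨n0, hn0⟩ := hne
  have p1 : 0 < ‖v N‖ := norm_pos_iff.2 fun h => hn0 (prop _ h _)
  have p2 : 0 < ‖v (-N)‖ := norm_pos_iff.2 fun h => hn0 (prop _ h _)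
  obtain ⟨k, hk1, hk2, hk3⟩ := ((R1.eventually_lt_const p1).and
    ((R2.eventually_lt_const p2).and (hl.eventually_ge_atTop (2 * N)))).exists
  rcases hper k with h | h
  · exact absurd (gordon_one A hdet v hv N C hC0 hC (l k) hk3 h) (not_le.2 hk1)
  · refine absurd (gordon_one A' hdet' v' hvr' N C' hC0' hC' (l k) hk3 ?_) (not_le.2 hk2)
    intro n h1 h2
    simp only [hA']
    rw [h (-(n + l k) - 1) (by omega) (by omega)]
    congr 2; ring

theorem word_eq {𝒜 : Type*} (ω : ℤ → 𝒜) (k : ℤ) (n : ℕ) :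
    word ω k n = (List.range n).map (fun i : ℕ => ω (k + (i : ℤ))) := by
  simp [word, List.map_eq_flatMap, List.flatMap_assoc]

theorem occ_per {𝒜 : Type*} (w : List 𝒜) (ω : ℤ → 𝒜) (k : ℤ)
    (h : occursAt (w ++ w ++ w) ω k) (i : ℤ) (h0 : k ≤ i) (h1 : i < k + 2 * w.length) :
    ω i = ω (i + w.length) := by
  obtain ⟨j, rfl⟩ := Int.le.dest h0
  have hj : j < 2 * w.length := by omega
  have key : ∀ m : ℕ, m < 3 * w.length → (w ++ w ++ w)[m]? = some (ω (k + m)) := by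
    intro m hm
    unfold occursAt at h
    have h3 : m < (w ++ w ++ w).length := by simp; omega
    rw [h, word_eq]
    rw [List.getElem?_map, List.getElem?_range h3, Option.map_some]
  have a := key j (by omega)
  have b := key (j + w.length) (by omega)
  have e : (w ++ w ++ w)[j]? = (w ++ w ++ w)[j + w.length]? := by
    rw [List.append_assoc, List.getElem?_append_right (l₁ := w) (i := j + w.length) (by omega),
      ← List.append_assoc, List.getElem?_append_left (l₁ := w ++ w) (by simp; omega)]
    simp
  rw [a, b] at e
  have := Option.some.inj e
  rw [this]; congr 1; push_cast; ring

theorem shift_mem_all {𝒜 : Type*} [TopologicalSpace 𝒜] {Ω : Set (ℤ → 𝒜)} (hΩ : IsSubshift Ω)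
    (ω : ℤ → 𝒜) (hω : ω ∈ Ω) (n : ℤ) : shift n ω ∈ Ω := by
  induction n using Int.induction_on with
  | zero =>
    have e : shift 0 ω = ω := by funext i; simp [shift]
    rw [e]; exact hω
  | succ n ih =>
    have := hΩ.shift_mem _ ih
    convert this using 1
    funext i; simp only [shift]; congr 1; ring
  | pred n ih =>
    have := hΩ.shift_neg_mem _ ih
    convert this using 1
    funext i; simp only [shift]; congr 1; ring

/-- If `ω` begins with cubes `w_k w_k w_k` around the origin for words
of unbounded length, then the Jacobi operator `H_ω` has no eigenvalues. -/
theorem statement19 {𝒜 : Type*} [Fintype 𝒜] [TopologicalSpace 𝒜] [DiscreteTopology 𝒜]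
    {Ω : Set (ℤ → 𝒜)} (hΩ : IsSubshift Ω)
    (f g : (ℤ → 𝒜) → ℝ) (hf : LocConstOn Ω f) (hg : LocConstOn Ω g)
    (hf0 : ∀ ω ∈ Ω, f ω ≠ 0)
    (ω : ℤ → 𝒜) (hω : ω ∈ Ω)
    (w : ℕ → List 𝒜) (hlen : Filter.Tendsto (fun k => (w k).length) Filter.atTop Filter.atTop)
    (hocc : ∀ k, occursAt (w k ++ w k ++ w k) ω (-((w k).length : ℤ)) ∨
      occursAt (w k ++ w k ++ w k) ω (-(2 * ((w k).length : ℤ))))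
    (H : Ell2Z →L[ℝ] Ell2Z) (hH : IsJacobiAt f g ω H)
    (E : ℝ) (u : Ell2Z) (hu : H u = E • u) (hu0 : u ≠ 0) : False := by
  obtain ⟨Nf, hNf⟩ := hf
  obtain ⟨Ng, hNg⟩ := hg
  have hmem := shift_mem_all hΩ ω hω
  set N : ℕ := Nf + Ng + 1 with hN
  set F : ℤ → ℝ := fun n => f (shift n ω) with hF
  set G : ℤ → ℝ := fun n => g (shift n ω) with hG
  have hF0 : ∀ n, F n ≠ 0 := fun n => hf0 _ (hmem n)
  set A : ℤ → Matrix (Fin 2) (Fin 2) ℝ := fun n =>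
    !![(E - G n) / F (n + 1), -1 / F (n + 1); F (n + 1), 0] with hA
  set v : ℤ → Fin 2 → ℝ := fun n => ![u n, F n * u (n - 1)] with hv
  have hdet : ∀ n, (A n).det = 1 := by
    intro n
    have := hF0 (n + 1)
    simp only [hA, Matrix.det_fin_two_of]
    field_simp
    ring
  have hloc : ∀ n m : ℤ, (∀ i : ℤ, |i| ≤ (N : ℤ) → ω (n + i) = ω (m + i)) → A n = A m := by
    intro n m h
    have e1 : F (n + 1) = F (m + 1) := by
      apply hNf _ (hmem _) _ (hmem _)
      intro i hi
      have := h (i + 1) (by grind)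
      simp only [shift]
      convert this using 2 <;> ring
    have e2 : G n = G m := by
      apply hNg _ (hmem _) _ (hmem _)
      intro i hi
      have := h i (by grind)
      simp only [shift]
      convert this using 2 <;> ring
    simp only [hA, e1, e2]
  have hfin : (Set.range A).Finite := by
    let r : ℤ → (Fin (2 * N + 1) → 𝒜) := fun n i => ω (n + ((i : ℕ) - N : ℤ))
    have hfac : Function.FactorsThrough A r := by
      intro n m h
      apply hloc
      intro i hi
      have := congrFun h ⟨(i + N).toNat, by grind⟩
      simp only [r] at this
      rw [Int.toNat_of_nonneg (by grind)] at this
      simpa using this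
    refine (Set.finite_range (Function.extend r A (fun _ => 0))).subset ?_
    rintro _ ⟨n, rfl⟩
    exact ⟨r n, hfac.extend_apply _ n⟩
  have heq : ∀ n, F n * u (n - 1) + F (n + 1) * u (n + 1) + G n * u n = E * u n := by
    intro n
    rw [← hH u n, hu]
    simp
  have hrec : ∀ n, v (n + 1) = (A n).mulVec (v n) := by
    intro n
    have h := heq n
    have h0 := hF0 (n + 1)
    ext i
    fin_cases i
    · simp [hA, hv, Matrix.mulVec, dotProduct, Fin.sum_univ_two]
      field_simp
      linear_combination h
    · simp [hA, hv, Matrix.mulVec, dotProduct, Fin.sum_univ_two]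
  have hu_lim : Tendsto (fun n : ℤ => (u : ∀ _ : ℤ, ℝ) n) cofinite (𝓝 0) := by
    have h := (lp.memℓp u).summable (by norm_num)
    have h2 := h.tendsto_cofinite_zero
    simp [-Int.cofinite_eq] at h2
    have h3 := h2.sqrt
    simp only [Real.sqrt_sq_eq_abs, Real.sqrt_zero] at h3
    exact (tendsto_zero_iff_abs_tendsto_zero _).2 h3
  have hFrange : (Set.range F).Finite := by
    have : Set.range F ⊆ (fun M : Matrix (Fin 2) (Fin 2) ℝ => M 1 0) '' Set.range A := by
      rintro _ ⟨n, rfl⟩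
      refine ⟨A (n - 1), ⟨_, rfl⟩, ?_⟩
      simp [hA]
    exact (hfin.image _).subset this
  have hv0 : Tendsto v cofinite (𝓝 0) := by
    rw [tendsto_pi_nhds]
    have hu1 : Tendsto (fun n : ℤ => (u : ∀ _ : ℤ, ℝ) (n - 1)) cofinite (𝓝 0) :=
      hu_lim.comp (sub_left_injective.tendsto_cofinite)
    intro i
    fin_cases i
    · simpa [hv] using hu_lim
    · obtain ⟨C, hC⟩ := (hFrange.image (fun x => |x|)).bddAbove
      have hb : ∀ n, |F n| ≤ C := fun n => hC ⟨_, ⟨n, rfl⟩, rfl⟩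
      have := hu1.abs.const_mul C
      simp only [abs_zero, mul_zero] at this
      simp only [hv]
      refine squeeze_zero_norm (fun n => ?_) this
      simp [abs_mul]
      exact mul_le_mul_of_nonneg_right (hb n) (abs_nonneg _)
  have hz := gordon_main A hdet hfin v hrec hv0 N (fun k => (w k).length) hlen ?_
  · apply hu0
    ext n
    have := congrFun (hz n) 0
    simpa [hv] using this
  · intro k
    refine (hocc k).imp ?_ ?_
    · intro h n h1 h2
      apply hloc
      intro i hi
      have hi' := abs_le.1 hi
      rw [occ_per (w k) ω _ h (n + i) (by omega) (by omega)]
      congr 1; ring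
    · intro h n h1 h2
      apply hloc
      intro i hi
      have hi' := abs_le.1 hi
      rw [occ_per (w k) ω _ h (n + i) (by omega) (by omega)]
      congr 1; ring
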